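/- arXiv:2407.10556 — 2 statements merged into one kernel-verified Lean document; each statement's English description precedes it below -/
import Mathlib

section
/- Let G be an equatorial graph with girth g and equator q, and let {L_0, …, L_{q−1}} be the partition of G induced by an isometric cycle of length q. Then |L_i| = |L_{i+g}| for all i ∈ [0, q−1], subscripts taken mod q. -/
open SimpleGraph

/-- The distance between two indices around a cycle of length `q`. -/
def cycleDist {q : ℕ} (i j : ZMod q) : ℕ := min (i - j).val (j - i).val

/-- `f` lists the vertices (in cyclic order) of an isometric cycle of length `q` in `G`:
the distance in `G` between any two of its vertices equals their distance along the cycle. -/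
def IsIsoCycle {V : Type*} (G : SimpleGraph V) (q : ℕ) (f : ZMod q → V) : Prop :=
  3 ≤ q ∧ ∀ i j : ZMod q, G.dist (f i) (f j) = cycleDist i j

/-- `G` has an isometric cycle of length `q`. -/
def HasIsoCycle {V : Type*} (G : SimpleGraph V) (q : ℕ) : Prop :=
  ∃ f : ZMod q → V, IsIsoCycle G q f

/-- The equator of `G` is `q`: `q` is the length of a longest isometric cycle of `G`
(`0` if `G` has no isometric cycle, e.g. if `G` is acyclic). -/
def IsEquator {V : Type*} (G : SimpleGraph V) (q : ℕ) : Prop :=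
  (HasIsoCycle G q ∨ (q = 0 ∧ ∀ q', ¬ HasIsoCycle G q')) ∧ ∀ q', HasIsoCycle G q' → q' ≤ q

/-- The degree of a vertex, as the cardinality of its neighbor set. -/
noncomputable def ndeg {V : Type*} (G : SimpleGraph V) (v : V) : ℕ := (G.neighborSet v).ncard

/-- `G` has minimum degree `δ`. -/
def HasMinDegree {V : Type*} (G : SimpleGraph V) (δ : ℕ) : Prop :=
  (∀ v, δ ≤ ndeg G v) ∧ ∃ v, ndeg G v = δ

/-- The Moore bound `M(δ, g)`. -/
def mooreBound (δ g : ℕ) : ℕ :=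
  if Odd g then 1 + δ * ∑ i ∈ Finset.range ((g + 1) / 2 - 1), (δ - 1) ^ i
  else 2 + ∑ i ∈ Finset.Icc 1 ((g + 1) / 2 - 1), 2 * (δ - 1) ^ i

/-- The disk of radius `k` around a vertex `u`. -/
def disk {V : Type*} (G : SimpleGraph V) (k : ℕ) (u : V) : Set V := {v | G.dist u v ≤ k}

/-- The disk of radius `k` around an edge `uv`. -/
def edisk {V : Type*} (G : SimpleGraph V) (k : ℕ) (u v : V) : Set V :=
  disk G k u ∪ disk G k v

/-- `G` is an equatorial graph with minimum degree `δ`, girth `g` and equator `q`: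
a finite connected simple graph with girth `g`, minimum degree `δ`, equator `q > 6k + 3`
(where `k = ⌈g/2⌉ - 1`) whose order attains the bound `n = (q/g) · M(δ, g)`. -/
def IsEquatorial {V : Type*} (G : SimpleGraph V) (δ g q : ℕ) : Prop :=
  Finite V ∧ G.Connected ∧ G.girth = g ∧ HasMinDegree G δ ∧ IsEquator G q ∧
    6 * ((g + 1) / 2 - 1) + 3 < q ∧ g * Nat.card V = q * mooreBound δ g

/-- The part `L i` of the partition induced by the isometric cycle `f`:
`L i = D_k(u_{i-k}) ∩ D_k(u_{i+k})`. -/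
def Lpart {V : Type*} (G : SimpleGraph V) (k : ℕ) {q : ℕ} (f : ZMod q → V) (i : ZMod q) :
    Set V :=
  disk G k (f (i - (k : ZMod q))) ∩ disk G k (f (i + (k : ZMod q)))

namespace SimpleGraph

variable {V : Type*} {G : SimpleGraph V}

/-- Two paths with the same ends whose total length is below the girth coincide. -/
theorem Walk.IsPath.eq_of_length_add_lt_girth {u v : V} {p r : G.Walk u v}
    (hp : p.IsPath) (hr : r.IsPath) (h : p.length + r.length < G.girth) : p = r := by
  classical
  set H : SimpleGraph V := fromEdgeSet {e | e ∈ p.edges ∨ e ∈ r.edges} with hH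
  have hmem : ∀ {w w' : V} (s : G.Walk w w'), (∀ e ∈ s.edges, e ∈ p.edges ∨ e ∈ r.edges) →
      ∀ e ∈ s.edges, e ∈ H.edgeSet := by
    intro w w' s hs e he
    rw [hH, edgeSet_fromEdgeSet]
    exact ⟨hs e he, G.not_isDiag_of_mem_edgeSet (s.edges_subset_edgeSet he)⟩
  have hpH := hmem p fun e he => Or.inl he
  have hrH := hmem r fun e he => Or.inr he
  have hHG : H ≤ G := by
    intro a b hab
    rw [hH, fromEdgeSet_adj] at hab
    rcases hab.1 with h' | h'
    · exact p.edges_subset_edgeSet h'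
    · exact r.edges_subset_edgeSet h'
  have hac : H.IsAcyclic := by
    intro w c hc
    have hle : c.length ≤ p.length + r.length := by
      have hsub : c.edges.toFinset ⊆ p.edges.toFinset ∪ r.edges.toFinset := by
        intro e he
        have h' := c.edges_subset_edgeSet (List.mem_toFinset.1 he)
        rw [hH, edgeSet_fromEdgeSet] at h'
        simpa using h'.1
      calc c.length = c.edges.toFinset.card := by
            rw [List.toFinset_card_of_nodup hc.edges_nodup, Walk.length_edges]
        _ ≤ _ := Finset.card_le_card hsub
        _ ≤ _ := Finset.card_union_le _ _
        _ ≤ _ := by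
            rw [← p.length_edges, ← r.length_edges]
            exact Nat.add_le_add (List.toFinset_card_le _) (List.toFinset_card_le _)
    have hg : G.girth ≤ (c.mapLe hHG).length := girth_le_length (hc.mapLe hHG)
    rw [Walk.length_mapLe] at hg
    omega
  have heq := (hac.subsingleton_path u v).elim
    ⟨p.transfer H hpH, hp.transfer hpH⟩ ⟨r.transfer H hrH, hr.transfer hrH⟩
  have heq' : p.transfer H hpH = r.transfer H hrH := congrArg Subtype.val heq
  have hs : p.support = r.support := by
    rw [← p.support_transfer hpH, heq', r.support_transfer]
  exact Walk.ext_support hs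

section Branch

variable [Fintype V]

open Classical in
/-- The vertices reached from `u` by a path of length at most `k` that avoids `x`. -/
noncomputable def branch (G : SimpleGraph V) (k : ℕ) (u x : V) : Finset V :=
  {v | ∃ p : G.Walk u v, p.IsPath ∧ p.length ≤ k ∧ x ∉ p.support}

theorem mem_branch {k : ℕ} {u x v : V} :
    v ∈ G.branch k u x ↔ ∃ p : G.Walk u v, p.IsPath ∧ p.length ≤ k ∧ x ∉ p.support := by
  simp [branch]

theorem dist_le_of_mem_branch {k : ℕ} {u x v : V} (h : v ∈ G.branch k u x) :
    G.dist u v ≤ k := by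
  obtain ⟨p, -, hl, -⟩ := mem_branch.1 h
  exact (dist_le p).trans hl

theorem disjoint_branch_of_adj {k : ℕ} (hg : 2 * k + 2 < G.girth) {u y z : V}
    (hy : G.Adj u y) (hz : G.Adj u z) (hyz : y ≠ z) :
    Disjoint (G.branch k y u) (G.branch k z u) := by
  rw [Finset.disjoint_left]
  intro v h₁ h₂
  obtain ⟨p, hp, hpl, hpu⟩ := mem_branch.1 h₁
  obtain ⟨r, hr, hrl, hru⟩ := mem_branch.1 h₂
  have h := (hp.cons (h := hy) hpu).eq_of_length_add_lt_girth (hr.cons (h := hz) hru)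
    (by simp only [Walk.length_cons]; omega)
  rw [Walk.cons.injEq] at h
  exact hyz h.1

open Classical in
theorem card_mul_add_one_le_card_insert_biUnion {k m : ℕ} (hg : 2 * k + 2 < G.girth) {u : V}
    (Y : Finset V) (hY : ∀ y ∈ Y, G.Adj u y) (hm : ∀ y ∈ Y, m ≤ (G.branch k y u).card) :
    Y.card * m + 1 ≤ (insert u (Y.biUnion fun y => G.branch k y u)).card := by
  rw [Finset.card_insert_of_notMem, Finset.card_biUnion]
  · gcongr
    simpa using Finset.card_nsmul_le_sum Y _ m hm
  · intro y hy z hz hyz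
    exact disjoint_branch_of_adj hg (hY y hy) (hY z hz) hyz
  · simp only [Finset.mem_biUnion, not_exists, not_and]
    intro y _ h
    obtain ⟨p, -, -, hpu⟩ := mem_branch.1 h
    exact hpu p.end_mem_support

theorem sum_pow_le_card_branch {δ : ℕ} (hδ : ∀ v, δ ≤ ndeg G v) (k : ℕ)
    (hg : 2 * k + 1 < G.girth) {u x : V} (hx : G.Adj u x) :
    ∑ i ∈ Finset.range (k + 1), (δ - 1) ^ i ≤ (G.branch k u x).card := by
  classical
  induction k generalizing u x with
  | zero =>
    have : u ∈ G.branch 0 u x := mem_branch.2 ⟨Walk.nil, by simp [hx.ne']⟩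
    simpa using Finset.card_pos.2 ⟨u, this⟩
  | succ k ih =>
    set Y := (G.neighborFinset u).erase x with hYdef
    have hY : ∀ y ∈ Y, G.Adj u y := fun y hy =>
      (G.mem_neighborFinset u y).1 (Finset.mem_of_mem_erase hy)
    have hYc : δ - 1 ≤ Y.card := by
      rw [hYdef, Finset.card_erase_of_mem (by simpa using hx)]
      have := hδ u
      rw [ndeg, ← coe_neighborFinset, Set.ncard_coe_finset] at this
      omega
    have hsub : insert u (Y.biUnion fun y => G.branch k y u) ⊆ G.branch (k + 1) u x := by
      intro v hv
      rw [Finset.mem_insert, Finset.mem_biUnion] at hv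
      rcases hv with rfl | ⟨y, hy, hv⟩
      · exact mem_branch.2 ⟨Walk.nil, by simp [hx.ne']⟩
      · obtain ⟨p, hp, hpl, hpu⟩ := mem_branch.1 hv
        refine mem_branch.2 ⟨p.cons (hY y hy), hp.cons hpu, by simpa using hpl, ?_⟩
        rw [Walk.support_cons, List.mem_cons, not_or]
        refine ⟨hx.ne', fun hxp => ?_⟩
        have hshort : (p.takeUntil x hxp).length ≤ k :=
          (p.length_takeUntil_le_length hxp).trans hpl
        have hne : u ∉ (p.takeUntil x hxp).support := fun h =>
          hpu (p.support_takeUntil_subset_support hxp h)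
        have hpath : (Walk.nil.cons hx : G.Walk u x).IsPath := by simp [hx.ne]
        have h := ((hp.takeUntil hxp).cons (h := hY y hy) hne).eq_of_length_add_lt_girth hpath
          (by simp only [Walk.length_cons, Walk.length_nil]; omega)
        rw [Walk.cons.injEq] at h
        exact Finset.ne_of_mem_erase hy h.1
    have hcard := card_mul_add_one_le_card_insert_biUnion (G := G) (k := k) (by omega) Y hY
      fun y hy => ih (by omega) (hY y hy).symm
    calc ∑ i ∈ Finset.range (k + 1 + 1), (δ - 1) ^ i
        = (δ - 1) * ∑ i ∈ Finset.range (k + 1), (δ - 1) ^ i + 1 := by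
          rw [Finset.sum_range_succ', Finset.mul_sum]
          simp [pow_succ, mul_comm]
      _ ≤ Y.card * ∑ i ∈ Finset.range (k + 1), (δ - 1) ^ i + 1 := by gcongr
      _ ≤ _ := hcard.trans (Finset.card_le_card hsub)

open Classical in
/-- The Moore bound for the disk around a vertex, for odd girth. -/
theorem mooreBound_le_card_disk {δ k : ℕ} (hδ : ∀ v, δ ≤ ndeg G v)
    (hg : G.girth = 2 * k + 1) (u : V) :
    mooreBound δ (2 * k + 1) ≤ (Finset.univ.filter fun v => G.dist u v ≤ k).card := by
  have hk : (2 * k + 1 + 1) / 2 - 1 = k := by omega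
  rw [mooreBound, if_pos ⟨k, rfl⟩, hk]
  cases k with
  | zero => simpa using Finset.card_pos.2 ⟨u, by simp⟩
  | succ k =>
    have hY : ∀ y ∈ G.neighborFinset u, G.Adj u y := fun y hy => (G.mem_neighborFinset u y).1 hy
    have hcard := card_mul_add_one_le_card_insert_biUnion (G := G) (k := k) (by omega) _ hY
      fun y hy => sum_pow_le_card_branch hδ k (by omega) (hY y hy).symm
    have hdeg : δ ≤ (G.neighborFinset u).card := by
      have := hδ u
      rwa [ndeg, ← coe_neighborFinset, Set.ncard_coe_finset] at this
    calc 1 + δ * ∑ i ∈ Finset.range (k + 1), (δ - 1) ^ i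
        ≤ (G.neighborFinset u).card * ∑ i ∈ Finset.range (k + 1), (δ - 1) ^ i + 1 := by
          rw [add_comm]; gcongr
      _ ≤ _ := hcard
      _ ≤ _ := Finset.card_le_card fun v hv => by
          rw [Finset.mem_insert, Finset.mem_biUnion] at hv
          rw [Finset.mem_filter]
          refine ⟨Finset.mem_univ _, ?_⟩
          rcases hv with rfl | ⟨y, hy, hv⟩
          · simp
          · obtain ⟨p, -, hpl, -⟩ := mem_branch.1 hv
            exact (dist_le (p.cons (hY y hy))).trans (by simpa using hpl)

open Classical in
/-- The Moore bound for the disk around an edge, for even girth. -/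
theorem mooreBound_le_card_edisk {δ k : ℕ} (hδ : ∀ v, δ ≤ ndeg G v)
    (hg : G.girth = 2 * k + 2) {u w : V} (huw : G.Adj u w) :
    mooreBound δ (2 * k + 2) ≤
      (Finset.univ.filter fun v => G.dist u v ≤ k ∨ G.dist w v ≤ k).card := by
  have hk : (2 * k + 2 + 1) / 2 - 1 = k := by omega
  have hodd : ¬ Odd (2 * k + 2) := by rw [Nat.not_odd_iff]; omega
  have hdisj : Disjoint (G.branch k u w) (G.branch k w u) := by
    rw [Finset.disjoint_left]
    intro v h₁ h₂
    obtain ⟨p, hp, hpl, hpw⟩ := mem_branch.1 h₁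
    obtain ⟨r, hr, hrl, hru⟩ := mem_branch.1 h₂
    have h := (hp.cons (h := huw.symm) hpw).eq_of_length_add_lt_girth hr
      (by simp only [Walk.length_cons]; omega)
    exact hru (h ▸ by simp)
  rw [mooreBound, if_neg hodd, hk]
  calc 2 + ∑ i ∈ Finset.Icc 1 k, 2 * (δ - 1) ^ i
      = ∑ i ∈ Finset.range (k + 1), (δ - 1) ^ i + ∑ i ∈ Finset.range (k + 1), (δ - 1) ^ i := by
        rw [← two_mul, Finset.mul_sum, Finset.range_eq_Ico,
          Finset.sum_eq_sum_Ico_succ_bot (by omega)]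
        rfl
    _ ≤ (G.branch k u w).card + (G.branch k w u).card := Nat.add_le_add
        (sum_pow_le_card_branch hδ k (by omega) huw)
        (sum_pow_le_card_branch hδ k (by omega) huw.symm)
    _ = (G.branch k u w ∪ G.branch k w u).card := (Finset.card_union_of_disjoint hdisj).symm
    _ ≤ _ := Finset.card_le_card fun v hv => by
        rw [Finset.mem_union] at hv
        rw [Finset.mem_filter]
        exact ⟨Finset.mem_univ _, hv.imp dist_le_of_mem_branch dist_le_of_mem_branch⟩

end Branch

end SimpleGraph

section CyclicIndices

variable {q : ℕ}

theorem ZMod.natCast_inj_of_lt {a b : ℕ} (ha : a < q) (hb : b < q)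
    (h : (a : ZMod q) = (b : ZMod q)) : a = b := by
  rw [ZMod.natCast_eq_natCast_iff] at h
  exact Nat.ModEq.eq_of_lt_of_lt h ha hb

theorem exists_natCast_of_cycleDist_le [NeZero q] {m : ℕ} {i j : ZMod q}
    (h : cycleDist i j ≤ m) : ∃ x ≤ m, i = j + (x : ZMod q) ∨ j = i + (x : ZMod q) := by
  rcases min_le_iff.1 h with h | h
  · exact ⟨_, h, Or.inl (by simp)⟩
  · exact ⟨_, h, Or.inr (by simp)⟩

/-- Indices at pairwise cyclic distance at most `m`, with `m` below a third of the length, lie on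
an arc of `m + 1` indices. -/
theorem exists_arc_of_cycleDist_le {m : ℕ} (hq : 3 * m < q) {P : ZMod q → Prop}
    {s₀ : ZMod q} (h₀ : P s₀) (hP : ∀ i j, P i → P j → cycleDist i j ≤ m) :
    ∃ a, ∀ i, P i → ∃ t ≤ m, i = a + (t : ZMod q) := by
  classical
  have : NeZero q := ⟨by omega⟩
  set b : ZMod q := s₀ - (m : ZMod q) with hb
  have hlift : ∀ i, P i → ∃ t ≤ 2 * m, i = b + (t : ZMod q) := by
    intro i hi
    obtain ⟨x, hx, h | h⟩ := exists_natCast_of_cycleDist_le (hP i s₀ hi h₀)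
    · exact ⟨m + x, by omega, by rw [h, hb]; push_cast; ring⟩
    · exact ⟨m - x, by omega, by rw [hb, h, Nat.cast_sub hx]; ring⟩
  have hex : ∃ t : ℕ, P (b + (t : ZMod q)) := by
    obtain ⟨t, -, h⟩ := hlift s₀ h₀
    exact ⟨t, h ▸ h₀⟩
  refine ⟨b + (Nat.find hex : ZMod q), fun i hi => ?_⟩
  obtain ⟨t, ht, rfl⟩ := hlift i hi
  have hmin : Nat.find hex ≤ t := Nat.find_min' hex hi
  obtain ⟨x, hx, h | h⟩ := exists_natCast_of_cycleDist_le (hP _ _ hi (Nat.find_spec hex))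
  · exact ⟨x, hx, h⟩
  · rw [add_assoc, add_right_inj, ← Nat.cast_add] at h
    have := ZMod.natCast_inj_of_lt (by omega) (by omega) h
    exact ⟨0, by omega, by rw [show t = Nat.find hex by omega]; simp⟩

/-- The arc of `g` consecutive indices starting at `c`. -/
def arc (c : ZMod q) (g : ℕ) : Finset (ZMod q) :=
  (Finset.range g).image fun t : ℕ => c + (t : ZMod q)

theorem mem_arc {c i : ZMod q} {g : ℕ} : i ∈ arc c g ↔ ∃ t < g, i = c + (t : ZMod q) := by
  simp [arc, eq_comm]

theorem card_arc_le (c : ZMod q) (g : ℕ) : (arc c g).card ≤ g :=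
  Finset.card_image_le.trans (Finset.card_range g).le

/-- The indices `i` with `P i` or `P (i + e)` lie on an arc of `2k + 1 + e` indices. -/
theorem filter_subset_arc [NeZero q] {k e : ℕ} (he : e ≤ 1) {P : ZMod q → Prop}
    [DecidablePred P] {a : ZMod q} (ha : ∀ i, P i → ∃ t ≤ 2 * k, i = a + (t : ZMod q)) :
    (Finset.univ.filter fun i => P i ∨ P (i + (e : ZMod q))) ⊆
      arc (a - (e : ZMod q)) (2 * k + 1 + e) := by
  intro i hi
  rw [mem_arc]
  rcases (Finset.mem_filter.1 hi).2 with h | h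
  · obtain ⟨t, ht, rfl⟩ := ha i h
    exact ⟨t + e, by omega, by push_cast; ring⟩
  · obtain ⟨t, ht, h'⟩ := ha _ h
    exact ⟨t, by omega, by rw [eq_sub_of_add_eq h']; ring⟩

theorem card_filter_le_of_cycleDist_le [NeZero q] {k e : ℕ} (he : e ≤ 1) (hq : 6 * k + 3 < q)
    {P : ZMod q → Prop} [DecidablePred P]
    (hP : ∀ i j, P i → P j → cycleDist i j ≤ 2 * k) :
    (Finset.univ.filter fun i => P i ∨ P (i + (e : ZMod q))).card ≤ 2 * k + 1 + e := by
  by_cases h₀ : ∃ s, P s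
  · obtain ⟨s, hs⟩ := h₀
    obtain ⟨a, ha⟩ := exists_arc_of_cycleDist_le (by omega) hs hP
    exact (Finset.card_le_card (filter_subset_arc he ha)).trans (card_arc_le _ _)
  · push Not at h₀
    simp [h₀]

/-- If the indices `i` with `P i` or `P (i + e)` are as many as possible, they form an arc, and
the middle of the arc of indices satisfying `P` is determined by its two ends. -/
theorem exists_arc_of_card_filter_eq [NeZero q] {k e : ℕ} (he : e ≤ 1) (hq : 6 * k + 3 < q)
    {P : ZMod q → Prop} [DecidablePred P]
    (hP : ∀ i j, P i → P j → cycleDist i j ≤ 2 * k)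
    (hcard : (Finset.univ.filter fun i => P i ∨ P (i + (e : ZMod q))).card = 2 * k + 1 + e) :
    ∃ c : ZMod q, (∀ i, P i ∨ P (i + (e : ZMod q)) ↔ i ∈ arc c (2 * k + 1 + e)) ∧
      ∀ j, P (j - (k : ZMod q)) ∧ P (j + (k : ZMod q)) ↔ c = j - ((e + k : ℕ) : ZMod q) := by
  have h₀ : ∃ s, P s := by
    by_contra! h₀
    simp [h₀] at hcard
    omega
  obtain ⟨s, hs⟩ := h₀
  obtain ⟨a, ha⟩ := exists_arc_of_cycleDist_le (by omega) hs hP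
  have heq := Finset.eq_of_subset_of_card_le (filter_subset_arc he ha)
    ((card_arc_le _ _).trans hcard.ge)
  have hiff : ∀ i, P i ∨ P (i + (e : ZMod q)) ↔ i ∈ arc (a - (e : ZMod q)) (2 * k + 1 + e) := by
    intro i
    rw [← heq, Finset.mem_filter]
    simp
  refine ⟨a - (e : ZMod q), hiff, fun j => ⟨?_, ?_⟩⟩
  · rintro ⟨h₁, h₂⟩
    obtain ⟨t, ht, h₁⟩ := ha _ h₁
    obtain ⟨t', ht', h₂⟩ := ha _ h₂
    have h : ((t + 2 * k : ℕ) : ZMod q) = (t' : ZMod q) := by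
      push_cast
      linear_combination h₂ - h₁
    have ht0 : t = 0 := by
      have := ZMod.natCast_inj_of_lt (by omega) (by omega) h
      omega
    subst ht0
    push_cast at h₁ ⊢
    linear_combination -h₁
  · intro hj
    have hj' : j = a + (k : ZMod q) := by
      push_cast at hj
      linear_combination -hj
    subst hj'
    have hfirst : P a := by
      rcases (hiff (a - (e : ZMod q))).2 (mem_arc.2 ⟨0, by omega, by simp⟩) with h | h
      · obtain ⟨t, ht, h'⟩ := ha _ h
        have h'' : ((t + e : ℕ) : ZMod q) = ((0 : ℕ) : ZMod q) := by
          push_cast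
          linear_combination -h'
        have := ZMod.natCast_inj_of_lt (by omega) (by omega) h''
        have he0 : e = 0 := by omega
        simpa [he0] using h
      · simpa using h
    have hlast : P (a + ((2 * k : ℕ) : ZMod q)) := by
      rcases (hiff (a + ((2 * k : ℕ) : ZMod q))).2
        (mem_arc.2 ⟨2 * k + e, by omega, by push_cast; ring⟩) with h | h
      · exact h
      · obtain ⟨t, ht, h'⟩ := ha _ h
        rw [add_assoc, add_right_inj, ← Nat.cast_add] at h'
        have := ZMod.natCast_inj_of_lt (by omega) (by omega) h'
        have he0 : e = 0 := by omega
        simpa [he0] using h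
    refine ⟨by simpa using hfirst, ?_⟩
    convert hlast using 1
    push_cast
    ring

/-- If every index lies on equally many of the arcs of length `g` starting at the values of `c`,
then the fibres of `c` have sizes periodic with period `g`. -/
theorem card_fiber_add_eq {V : Type*} [Fintype V] {g M : ℕ} (hg : g ≤ q) (c : V → ZMod q)
    (hM : ∀ i, (Finset.univ.filter fun v => i ∈ arc (c v) g).card = M) (i : ZMod q) :
    (Finset.univ.filter fun v => c v = i).card =
      (Finset.univ.filter fun v => c v = i + (g : ZMod q)).card := by
  classical
  have hsum : ∀ j : ZMod q, ∑ t ∈ Finset.range g,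
      (Finset.univ.filter fun v => c v = j - (t : ZMod q)).card = M := by
    intro j
    rw [← hM j, ← Finset.card_biUnion]
    · congr 1
      ext v
      simp [mem_arc, eq_sub_iff_add_eq, eq_comm]
    · intro t ht t' ht' hne
      rw [Function.onFun, Finset.disjoint_left]
      intro v h₁ h₂
      rw [Finset.mem_filter] at h₁ h₂
      have h := h₁.2.symm.trans h₂.2
      rw [sub_right_inj] at h
      have ht := Finset.mem_range.1 ht
      have ht' := Finset.mem_range.1 ht'
      exact hne (ZMod.natCast_inj_of_lt (by omega) (by omega) h)
  have h₁ := Finset.sum_range_succ (fun t : ℕ =>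
    (Finset.univ.filter fun v => c v = i + (g : ZMod q) - (t : ZMod q)).card) g
  rw [Finset.sum_range_succ', hsum] at h₁
  have h₂ := hsum (i + (g : ZMod q) - 1)
  have h₃ : ∀ t : ℕ, i + (g : ZMod q) - ((t + 1 : ℕ) : ZMod q) =
      i + (g : ZMod q) - 1 - (t : ZMod q) := by
    intro t
    push_cast
    ring
  simp only [h₃, h₂, Nat.cast_zero, sub_zero, add_sub_cancel_right] at h₁
  omega

end CyclicIndices

/-- Consecutive vertices of an isometric cycle are adjacent. -/
theorem IsIsoCycle.adj_add_one {V : Type*} {G : SimpleGraph V} {q : ℕ} {f : ZMod q → V}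
    (hf : IsIsoCycle G q f) (i : ZMod q) : G.Adj (f i) (f (i + 1)) := by
  have hq := hf.1
  have : Fact (1 < q) := ⟨by omega⟩
  have : NeZero q := ⟨by omega⟩
  rw [← dist_eq_one_iff_adj, hf.2, cycleDist]
  have h₁ : (i - (i + 1)).val ≠ 0 := by
    rw [Ne, ZMod.val_eq_zero]
    simp
  have h₂ : (i + 1 - i).val = 1 := by
    rw [add_sub_cancel_left, ZMod.val_one]
  omega

/-- A family of `q` sets of size at least `M` covering each point at most `g` times, where
`g * |V| = q * M`, consists of sets of size `M` and covers each point exactly `g` times. -/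
theorem card_eq_of_double_count {ι V : Type*} [Fintype ι] [Fintype V] (R : ι → V → Prop)
    [∀ i v, Decidable (R i v)] {g M : ℕ}
    (hM : ∀ i, M ≤ (Finset.univ.filter fun v => R i v).card)
    (hg : ∀ v, (Finset.univ.filter fun i => R i v).card ≤ g)
    (h : g * Fintype.card V = Fintype.card ι * M) :
    (∀ i, (Finset.univ.filter fun v => R i v).card = M) ∧
      ∀ v, (Finset.univ.filter fun i => R i v).card = g := by
  have hcount : ∑ i, (Finset.univ.filter fun v => R i v).card =
      ∑ v, (Finset.univ.filter fun i => R i v).card :=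
    Finset.sum_card_bipartiteAbove_eq_sum_card_bipartiteBelow R
  have hlow : ∑ _i : ι, M ≤ ∑ i, (Finset.univ.filter fun v => R i v).card :=
    Finset.sum_le_sum fun i _ => hM i
  have hup : ∑ v, (Finset.univ.filter fun i => R i v).card ≤ ∑ _v : V, g :=
    Finset.sum_le_sum fun v _ => hg v
  have htot : ∑ _v : V, g = ∑ _i : ι, M := by simp [← h, mul_comm]
  constructor
  · intro i
    exact ((Finset.sum_eq_sum_iff_of_le fun i _ => hM i).1 (by omega) i (Finset.mem_univ i)).symm
  · intro v
    exact (Finset.sum_eq_sum_iff_of_le fun v _ => hg v).1 (by omega) v (Finset.mem_univ v)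

/-- Lemma 5.11: `|L i| = |L (i + g)|` for all `i` (subscripts mod `q`). -/
theorem stmt_15 {V : Type*} (G : SimpleGraph V) (δ g q k : ℕ)
    (hG : IsEquatorial G δ g q) (hk : k = (g + 1) / 2 - 1)
    (f : ZMod q → V) (hf : IsIsoCycle G q f) :
    ∀ i : ZMod q, (Lpart G k f i).ncard = (Lpart G k f (i + (g : ZMod q))).ncard := by
  classical
  obtain ⟨hfin, hconn, hgirth, ⟨hδ, -⟩, -, hq, hn⟩ := hG
  have := Fintype.ofFinite V
  rw [← hk] at hq
  have hq0 : 0 < q := by omega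
  have : NeZero q := ⟨hq0.ne'⟩
  have hMpos : 0 < mooreBound δ g := by
    unfold mooreBound
    split_ifs <;> omega
  have hg0 : g ≠ 0 := by
    rintro rfl
    simp [hq0.ne', hMpos.ne'] at hn
  obtain ⟨e, he, hge⟩ : ∃ e ≤ 1, g = 2 * k + 1 + e := ⟨g - (2 * k + 1), by omega, by omega⟩
  have hpair : ∀ v i j, G.dist (f i) v ≤ k → G.dist (f j) v ≤ k → cycleDist i j ≤ 2 * k := by
    intro v i j hi hj
    rw [← hf.2]
    have := hconn.dist_triangle (u := f i) (v := v) (w := f j)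
    rw [G.dist_comm (u := v)] at this
    omega
  have hmoore : ∀ i, mooreBound δ g ≤ (Finset.univ.filter fun v =>
      G.dist (f i) v ≤ k ∨ G.dist (f (i + (e : ZMod q))) v ≤ k).card := by
    intro i
    obtain rfl | rfl : e = 0 ∨ e = 1 := by omega
    · rw [hge]
      simpa using mooreBound_le_card_disk hδ (hgirth.trans hge) (f i)
    · rw [hge]
      simpa using mooreBound_le_card_edisk hδ (hgirth.trans hge) (hf.adj_add_one i)
  obtain ⟨hdisk, hcover⟩ := card_eq_of_double_count
    (fun i v => G.dist (f i) v ≤ k ∨ G.dist (f (i + (e : ZMod q))) v ≤ k) hmoore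
    (fun v => hge ▸ card_filter_le_of_cycleDist_le he hq (hpair v))
    (by rw [ZMod.card, ← Nat.card_eq_fintype_card, hn])
  choose c hc hL using fun v =>
    exists_arc_of_card_filter_eq he hq (hpair v) ((hcover v).trans hge)
  have hcard : ∀ j, (Lpart G k f j).ncard =
      (Finset.univ.filter fun v => c v = j - ((e + k : ℕ) : ZMod q)).card := by
    intro j
    rw [← Set.ncard_coe_finset]
    congr 1
    ext v
    simpa [Lpart, disk] using hL v j
  intro i
  simp only [hc, ← hge] at hdisk
  rw [hcard, hcard, card_fiber_add_eq (by omega) c hdisk, sub_add_eq_add_sub]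
end

section
/- Suppose there exists an equatorial graph with minimum degree δ, girth g and equator q. Then for every integer j ≥ 2, there exists an equatorial graph with minimum degree δ, girth g and equator j·q (in particular, a finite connected simple graph with minimum degree δ, girth g, equator j·q and order (j·q/g)·M(δ, g)). -/
open SimpleGraph

variable {V : Type*}

/-! ### Distances around a cycle -/

theorem cycleDist_le_iff {q : ℕ} [NeZero q] (i j : ZMod q) (n : ℕ) :
    cycleDist i j ≤ n ↔ ∃ d : ℤ, |d| ≤ n ∧ j = i + d := by
  unfold cycleDist
  rw [min_le_iff]
  constructor
  · rintro (h | h)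
    · refine ⟨-((i - j).val : ℤ), by rw [abs_neg, Nat.abs_cast]; exact_mod_cast h, ?_⟩
      simp
    · refine ⟨((j - i).val : ℤ), by rw [Nat.abs_cast]; exact_mod_cast h, ?_⟩
      simp
  · rintro ⟨d, hd, rfl⟩
    obtain ⟨n', rfl | rfl⟩ := d.eq_nat_or_neg
    · right
      rw [Nat.abs_cast] at hd
      simp only [add_sub_cancel_left, Int.cast_natCast, ZMod.val_natCast]
      exact (Nat.mod_le _ _).trans (by exact_mod_cast hd)
    · left
      rw [abs_neg, Nat.abs_cast] at hd
      simp only [Int.cast_neg, Int.cast_natCast, sub_add_cancel_left, neg_neg, ZMod.val_natCast]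
      exact (Nat.mod_le _ _).trans (by exact_mod_cast hd)

theorem intCast_zmod_inj {q : ℕ} {a b : ℤ} (h : (a : ZMod q) = b) (hab : |a - b| < q) :
    a = b := by
  have := (ZMod.intCast_eq_intCast_iff_dvd_sub a b q).1 h
  have := Int.eq_zero_of_abs_lt_dvd this (by rwa [abs_sub_comm])
  omega

theorem val_sub_add_val_sub {q : ℕ} [NeZero q] {i j : ZMod q} (h : i ≠ j) :
    (i - j).val + (j - i).val = q := by
  have : NeZero (i - j) := ⟨sub_ne_zero.2 h⟩
  have := ZMod.val_lt (i - j)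
  rw [← neg_sub i j, ZMod.val_neg_of_ne_zero]
  omega

theorem two_mul_cycleDist_le {q : ℕ} [NeZero q] (i j : ZMod q) : 2 * cycleDist i j ≤ q := by
  rcases eq_or_ne i j with rfl | h
  · simp [cycleDist]
  · have := val_sub_add_val_sub h
    unfold cycleDist
    omega

theorem cycleDist_add_natCast {q : ℕ} (i : ZMod q) {n : ℕ} (hn : n < q) :
    cycleDist i (i + n) = min n (q - n) := by
  have : NeZero q := ⟨by omega⟩
  rcases Nat.eq_zero_or_pos n with rfl | hpos
  · simp [cycleDist]
  have hv : ((i + n : ZMod q) - i).val = n := by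
    rw [add_sub_cancel_left, ZMod.val_natCast, Nat.mod_eq_of_lt hn]
  have hne : i ≠ i + n := by
    intro h
    rw [← h] at hv
    simp at hv
    omega
  have := val_sub_add_val_sub hne
  unfold cycleDist
  omega

/-- A graph laid out around a cycle `u` of length `N`: a position map `φ` onto `ZMod N` that
changes by at most one along edges, such that from each vertex one reaches the cycle, `k` places
further in either direction, within `k` steps. -/
structure CyclicLayout (G : SimpleGraph V) (N k : ℕ) (φ : V → ZMod N) (u : ZMod N → V) :
    Prop where
  pos_u : ∀ i, φ (u i) = i
  adj_u : ∀ i, G.Adj (u i) (u (i + 1))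
  step : ∀ v w, G.Adj v w → ∃ e : ℤ, |e| ≤ 1 ∧ φ w = φ v + e
  fwd : ∀ v, ∃ p : G.Walk v (u (φ v + k)), p.length ≤ k
  bwd : ∀ v, ∃ p : G.Walk v (u (φ v - k)), p.length ≤ k

theorem exists_pos_eq_of_walk {G : SimpleGraph V} {N : ℕ} {φ : V → ZMod N}
    (step : ∀ v w, G.Adj v w → ∃ e : ℤ, |e| ≤ 1 ∧ φ w = φ v + e) {v w : V} (p : G.Walk v w) :
    ∃ e : ℤ, |e| ≤ p.length ∧ φ w = φ v + e := by
  induction p with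
  | nil => exact ⟨0, by simp⟩
  | cons h p ih =>
    obtain ⟨e, he, h1⟩ := ih
    obtain ⟨e', he', h2⟩ := step _ _ h
    refine ⟨e' + e, ?_, by rw [h1, h2]; push_cast; ring⟩
    have := abs_add_le e' e
    rw [Walk.length_cons]
    push_cast
    omega

namespace CyclicLayout

variable {G : SimpleGraph V} {N k : ℕ} {φ : V → ZMod N} {u : ZMod N → V}

theorem exists_walk_u (h : CyclicLayout G N k φ u) (i : ZMod N) (n : ℕ) :
    ∃ p : G.Walk (u i) (u (i + n)), p.length = n := by
  induction n with
  | zero => exact ⟨Walk.nil.copy rfl (by simp), by simp⟩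
  | succ n ih =>
    obtain ⟨p, hp⟩ := ih
    exact ⟨(p.concat (h.adj_u _)).copy rfl (by push_cast; rw [add_assoc]), by simp [hp]⟩

theorem connected (h : CyclicLayout G N k φ u) [NeZero N] : G.Connected := by
  have : Nonempty V := ⟨u 0⟩
  refine ⟨fun v w => ?_⟩
  obtain ⟨p, -⟩ := h.fwd v
  obtain ⟨p', -⟩ := h.fwd w
  obtain ⟨r, -⟩ := h.exists_walk_u (φ v + k) ((φ w + k) - (φ v + k)).val
  have hr : φ v + k + (((φ w + k) - (φ v + k)).val : ZMod N) = φ w + k := by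
    rw [ZMod.natCast_zmod_val]
    ring
  rw [hr] at r
  exact ⟨p.append (r.append p'.reverse)⟩

theorem cycleDist_le_dist (h : CyclicLayout G N k φ u) [NeZero N] (v w : V) :
    cycleDist (φ v) (φ w) ≤ G.dist v w := by
  obtain ⟨p, hp⟩ := h.connected.exists_walk_length_eq_dist v w
  rw [cycleDist_le_iff, ← hp]
  exact exists_pos_eq_of_walk h.step p

theorem dist_u_add_le (h : CyclicLayout G N k φ u) (i : ZMod N) (n : ℕ) :
    G.dist (u i) (u (i + n)) ≤ n := by
  obtain ⟨p, hp⟩ := h.exists_walk_u i n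
  exact (dist_le p).trans hp.le

theorem dist_u (h : CyclicLayout G N k φ u) [NeZero N] (i j : ZMod N) :
    G.dist (u i) (u j) = cycleDist i j := by
  refine le_antisymm ?_ (by simpa only [h.pos_u] using h.cycleDist_le_dist (u i) (u j))
  refine le_min ?_ ?_
  · rw [SimpleGraph.dist_comm]
    simpa using h.dist_u_add_le j (i - j).val
  · simpa using h.dist_u_add_le i (j - i).val

theorem dist_fwd_le (h : CyclicLayout G N k φ u) (v : V) : G.dist v (u (φ v + k)) ≤ k :=
  (h.fwd v).elim fun p hp => (dist_le p).trans hp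

theorem dist_bwd_le (h : CyclicLayout G N k φ u) (v : V) : G.dist v (u (φ v - k)) ≤ k :=
  (h.bwd v).elim fun p hp => (dist_le p).trans hp

theorem dist_le_of_two_mul_le (h : CyclicLayout G N k φ u) [NeZero N] {v w : V} {n : ℕ}
    (hn : 2 * k ≤ n) (hvw : φ w = φ v + n) : G.dist v w ≤ n := by
  have h1 := h.dist_fwd_le v
  have h2 := h.dist_bwd_le w
  have h3 := h.dist_u_add_le (φ v + k) (n - 2 * k)
  have h4 : φ v + k + ((n - 2 * k : ℕ) : ZMod N) = φ w - k := by
    rw [hvw]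
    push_cast [hn]
    ring
  rw [h4] at h3
  have h5 := h.connected.dist_triangle (u := v) (v := u (φ v + k)) (w := w)
  have h6 := h.connected.dist_triangle (u := u (φ v + k)) (v := u (φ w - k)) (w := w)
  rw [SimpleGraph.dist_comm] at h2
  omega

theorem dist_le_four_mul (h : CyclicLayout G N k φ u) [NeZero N] {v w : V} {n : ℕ}
    (hn : n ≤ 2 * k) (hvw : φ w = φ v + n) : G.dist v w ≤ 4 * k := by
  have h1 := h.dist_fwd_le v
  have h2 := h.dist_bwd_le w
  have h3 := h.dist_u_add_le (φ w - k) (2 * k - n)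
  have h4 : φ w - k + ((2 * k - n : ℕ) : ZMod N) = φ v + k := by
    rw [hvw]
    push_cast [hn]
    ring
  rw [h4, SimpleGraph.dist_comm] at h3
  have h5 := h.connected.dist_triangle (u := v) (v := u (φ v + k)) (w := w)
  have h6 := h.connected.dist_triangle (u := u (φ v + k)) (v := u (φ w - k)) (w := w)
  rw [SimpleGraph.dist_comm] at h2
  omega

theorem dist_eq_cycleDist (h : CyclicLayout G N k φ u) [NeZero N] {v w : V}
    (hvw : 4 * k < G.dist v w) : G.dist v w = cycleDist (φ v) (φ w) := by
  refine le_antisymm (le_min ?_ ?_) (h.cycleDist_le_dist v w)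
  · have e : φ v = φ w + ((φ v - φ w).val : ZMod N) := by simp
    rw [SimpleGraph.dist_comm] at hvw ⊢
    by_cases hn : (φ v - φ w).val ≤ 2 * k
    · have := h.dist_le_four_mul hn e
      omega
    · exact h.dist_le_of_two_mul_le (by omega) e
  · have e : φ w = φ v + ((φ w - φ v).val : ZMod N) := by simp
    by_cases hn : (φ w - φ v).val ≤ 2 * k
    · have := h.dist_le_four_mul hn e
      omega
    · exact h.dist_le_of_two_mul_le (by omega) e

theorem le_of_hasIsoCycle (h : CyclicLayout G N k φ u) (hN : 8 * k + 2 ≤ N) {m : ℕ}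
    (hm : HasIsoCycle G m) : m ≤ N := by
  have : NeZero N := ⟨by omega⟩
  obtain ⟨c, h3, hc⟩ := hm
  have : NeZero m := ⟨by omega⟩
  have half : ∀ i, G.dist (c i) (c (i + (m / 2 : ℕ))) = m / 2 := fun i => by
    rw [hc, cycleDist_add_natCast _ (by omega)]
    omega
  have hle : m / 2 ≤ N / 2 := by
    rw [← half 0]
    by_cases h4 : 4 * k < G.dist (c 0) (c (0 + (m / 2 : ℕ)))
    · rw [h.dist_eq_cycleDist h4]
      have := two_mul_cycleDist_le (φ (c 0)) (φ (c (0 + (m / 2 : ℕ))))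
      omega
    · omega
  by_contra! hlt
  have hND : N = 2 * (m / 2) := by omega
  have hmD : m = 2 * (m / 2) + 1 := by omega
  generalize m / 2 = D at *
  have half' : ∀ i, G.dist (c i) (c (i + (D + 1 : ℕ))) = D := fun i => by
    rw [hc, cycleDist_add_natCast _ (by omega)]
    omega
  have antipode : ∀ v w, G.dist v w = D → φ w = φ v + D := fun v w hvw => by
    have h4 := h.dist_eq_cycleDist (v := v) (w := w) (by omega)
    have hne : φ v ≠ φ w := by
      intro he
      rw [he] at h4
      simp only [cycleDist, sub_self, ZMod.val_zero, min_self] at h4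
      omega
    have := val_sub_add_val_sub hne
    unfold cycleDist at h4
    have h5 : (φ w - φ v).val = D := by omega
    rw [← h5]
    rw [ZMod.natCast_zmod_val]
    ring
  have const : ∀ i, φ (c (i + 1)) = φ (c i) := fun i => by
    have h1 := antipode _ _ (half (i - D))
    have h2 := antipode _ _ (half' (i - D))
    rw [sub_add_cancel] at h1
    push_cast at h2
    rw [← add_assoc, sub_add_cancel] at h2
    rw [h1, h2]
  have const' : ∀ n : ℕ, φ (c n) = φ (c 0) := fun n => by
    induction n with
    | zero => simp
    | succ n ih => push_cast; rw [const, ih]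
  have h0 := antipode _ _ (half 0)
  rw [zero_add, const'] at h0
  have h1 : ((D : ℕ) : ZMod N) = 0 := by simpa using h0.symm
  rw [ZMod.natCast_eq_zero_iff] at h1
  have := Nat.le_of_dvd (by omega) h1
  omega

theorem isEquator (h : CyclicLayout G N k φ u) (hN : 8 * k + 3 ≤ N) : IsEquator G N := by
  have : NeZero N := ⟨by omega⟩
  exact ⟨.inl ⟨u, by omega, h.dist_u⟩, fun _ => h.le_of_hasIsoCycle (by omega)⟩

end CyclicLayout

/-! ### Short cycles and girth -/

theorem isAcyclic_fromEdgeSet_of_length_lt_girth {G : SimpleGraph V} {L : List (Sym2 V)}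
    (hL : ∀ e ∈ L, e ∈ G.edgeSet) (hlt : L.length < G.girth) :
    (fromEdgeSet {e | e ∈ L}).IsAcyclic := by
  intro v c hc
  have hle : fromEdgeSet {e | e ∈ L} ≤ G := fun a b hab => hL _ ((fromEdgeSet_adj _).1 hab).1
  have h1 := girth_le_length (hc.mapLe hle)
  have h2 : c.edges ⊆ L := fun e he => by
    have := c.edges_subset_edgeSet he
    rw [edgeSet_fromEdgeSet] at this
    exact this.1
  have h3 := (hc.isTrail.edges_nodup.subperm h2).length_le
  rw [Walk.length_edges] at h3
  rw [Walk.length_map] at h1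
  omega

theorem mem_edgeSet_fromEdgeSet {G : SimpleGraph V} {L : List (Sym2 V)}
    (hL : ∀ e ∈ L, e ∈ G.edgeSet) {e : Sym2 V} (he : e ∈ L) :
    e ∈ (fromEdgeSet {e | e ∈ L}).edgeSet := by
  rw [edgeSet_fromEdgeSet]
  exact ⟨he, G.not_isDiag_of_mem_edgeSet (hL e he)⟩

theorem girth_le_length_add_length {G : SimpleGraph V} {v w : V} {p r : G.Walk v w}
    (hp : p.IsPath) (hr : r.IsPath) (hne : p ≠ r) : G.girth ≤ p.length + r.length := by
  by_contra! hlt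
  have hL : ∀ e ∈ p.edges ++ r.edges, e ∈ G.edgeSet := fun e he => by
    rcases List.mem_append.1 he with he | he
    · exact p.edges_subset_edgeSet he
    · exact r.edges_subset_edgeSet he
  have hac := isAcyclic_fromEdgeSet_of_length_lt_girth hL (by simpa using hlt)
  have hp' : ∀ e ∈ p.edges, e ∈ (fromEdgeSet {e | e ∈ p.edges ++ r.edges}).edgeSet :=
    fun e he => mem_edgeSet_fromEdgeSet hL (List.mem_append_left _ he)
  have hr' : ∀ e ∈ r.edges, e ∈ (fromEdgeSet {e | e ∈ p.edges ++ r.edges}).edgeSet :=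
    fun e he => mem_edgeSet_fromEdgeSet hL (List.mem_append_right _ he)
  have heq := (hac.subsingleton_path v w).elim ⟨_, hp.transfer hp'⟩ ⟨_, hr.transfer hr'⟩
  have hs := congrArg (fun s => s.1.support) heq
  simp only [Walk.support_transfer] at hs
  exact hne (Walk.ext_support hs)

theorem isChain_edges_map {V' : Type*} {G' : SimpleGraph V'} {G : SimpleGraph V} (f : G' →g G)
    (hf : ∀ a b b', G'.Adj a b → G'.Adj a b' → f b = f b' → b = b') {a b : V'}
    (p : G'.Walk a b) (hp : p.edges.IsChain (· ≠ ·)) :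
    (p.map f).edges.IsChain (· ≠ ·) := by
  induction p with
  | nil => simp
  | cons h p ih =>
    cases p with
    | nil => simp
    | cons h' p =>
      simp only [Walk.map_cons, Walk.edges_cons, List.isChain_cons_cons] at hp ih ⊢
      refine ⟨fun he => hp.1 ?_, ih hp.2⟩
      rw [Sym2.eq_swap, Sym2.congr_right] at he
      rw [hf _ _ _ h.symm h' he, Sym2.eq_swap]

theorem girth_le_length_of_locally_injective {V' : Type*} {G' : SimpleGraph V'}
    {G : SimpleGraph V} (f : G' →g G)
    (hf : ∀ a b b', G'.Adj a b → G'.Adj a b' → f b = f b' → b = b') {a : V'}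
    {c : G'.Walk a a} (hc : c.IsCycle) : G.girth ≤ c.length := by
  by_contra! hlt
  have hL : ∀ e ∈ (c.map f).edges, e ∈ G.edgeSet := fun e he => Walk.edges_subset_edgeSet _ he
  have hac := isAcyclic_fromEdgeSet_of_length_lt_girth hL (by simpa using hlt)
  have hL' := fun e he => mem_edgeSet_fromEdgeSet hL (e := e) he
  have hch := isChain_edges_map f hf c hc.isTrail.edges_nodup.isChain
  have hpath := (hac.isPath_iff_isChain ((c.map f).transfer _ hL')).2 (by
    rwa [Walk.edges_transfer])
  have h0 := Walk.length_eq_zero_iff.2 (Walk.isPath_iff_nil.1 hpath)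
  simp only [Walk.length_transfer, Walk.length_map] at h0
  have := hc.three_le_length
  omega

/-! ### The cyclic cover -/

/-- The reduction `ZMod (j * q) → ZMod q`. -/
abbrev modHom (j q : ℕ) : ZMod (j * q) →+* ZMod q := ZMod.castHom (dvd_mul_left q j) (ZMod q)

/-- Vertices of the `j`-fold cyclic cover: a vertex together with a lift of its position. -/
abbrev CoverVertex {q : ℕ} (φ : V → ZMod q) (j : ℕ) :=
  {p : V × ZMod (j * q) // modHom j q p.2 = φ p.1}

/-- The `j`-fold cyclic cover of a graph along a position map `φ`. -/
def cyclicCover (G : SimpleGraph V) {q : ℕ} (φ : V → ZMod q) (j : ℕ) :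
    SimpleGraph (CoverVertex φ j) where
  Adj a b := G.Adj a.1.1 b.1.1 ∧ ∃ e : ℤ, |e| ≤ 1 ∧ b.1.2 = a.1.2 + e
  symm := ⟨fun a b ⟨h, e, he, hab⟩ => ⟨h.symm, -e, by rwa [abs_neg], by rw [hab]; simp⟩⟩
  loopless := ⟨fun _ h => h.1.ne rfl⟩

/-- The covering projection. -/
def coverProj (G : SimpleGraph V) {q : ℕ} (φ : V → ZMod q) (j : ℕ) : cyclicCover G φ j →g G where
  toFun a := a.1.1
  map_rel' h := h.1

section Cover

variable {G : SimpleGraph V} {q j : ℕ} {φ : V → ZMod q}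

theorem cover_ext {a b : CoverVertex φ j} {d e : ℤ} {x : ZMod (j * q)}
    (h : a.1.1 = b.1.1) (ha : a.1.2 = x + d) (hb : b.1.2 = x + e) (hde : |d - e| < q) :
    a = b := by
  have h1 := a.2
  have h2 := b.2
  rw [ha, map_add, map_intCast] at h1
  rw [hb, map_add, map_intCast, ← h, ← h1, add_right_inj] at h2
  have h3 := intCast_zmod_inj h2.symm hde
  exact Subtype.ext (Prod.ext h (by rw [ha, hb, h3]))

theorem coverProj_locally_injective (hq : 2 < q) (a b b' : CoverVertex φ j)
    (h : (cyclicCover G φ j).Adj a b) (h' : (cyclicCover G φ j).Adj a b')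
    (hb : coverProj G φ j b = coverProj G φ j b') : b = b' := by
  obtain ⟨-, e, he, h⟩ := h
  obtain ⟨-, e', he', h'⟩ := h'
  refine cover_ext hb h h' ?_
  have := abs_sub e e'
  omega

theorem exists_pos_eq_of_cover_walk {a b : CoverVertex φ j} (p : (cyclicCover G φ j).Walk a b) :
    ∃ e : ℤ, |e| ≤ p.length ∧ b.1.2 = a.1.2 + e :=
  exists_pos_eq_of_walk (φ := fun a : CoverVertex φ j => a.1.2) (G := cyclicCover G φ j)
    (fun _ _ h => And.right h) p

theorem exists_cover_adj
    (step : ∀ v w, G.Adj v w → ∃ e : ℤ, |e| ≤ 1 ∧ φ w = φ v + e)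
    (a : CoverVertex φ j) {w : V} (h : G.Adj a.1.1 w) :
    ∃ b : CoverVertex φ j, (cyclicCover G φ j).Adj a b ∧ b.1.1 = w := by
  obtain ⟨e, he, hw⟩ := step _ _ h
  exact ⟨⟨(w, a.1.2 + e), by simp only [map_add, map_intCast, a.2, hw]⟩, ⟨h, e, he, rfl⟩, rfl⟩

theorem exists_cover_walk
    (step : ∀ v w, G.Adj v w → ∃ e : ℤ, |e| ≤ 1 ∧ φ w = φ v + e)
    {v w : V} (p : G.Walk v w) (a : CoverVertex φ j)
    (ha : v = coverProj G φ j a) :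
    ∃ (b : CoverVertex φ j) (hb : w = coverProj G φ j b) (p' : (cyclicCover G φ j).Walk a b),
      p'.map (coverProj G φ j) = p.copy ha hb ∧ p'.length = p.length := by
  induction p generalizing a with
  | nil => exact ⟨a, ha, Walk.nil, by subst ha; rfl, rfl⟩
  | cons h p ih =>
    subst ha
    obtain ⟨b, hab, hb⟩ := exists_cover_adj step a h
    obtain ⟨c, hc, p', hp', hlen⟩ := ih b hb.symm
    subst hb hc
    exact ⟨c, rfl, Walk.cons hab p', by
      simp only [Walk.map_cons, hp', Walk.copy_rfl_rfl]
      rfl, by simp [hlen]⟩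

theorem ndeg_cyclicCover
    (step : ∀ v w, G.Adj v w → ∃ e : ℤ, |e| ≤ 1 ∧ φ w = φ v + e)
    (hq : 2 < q) (a : CoverVertex φ j) :
    ndeg (cyclicCover G φ j) a = ndeg G a.1.1 := by
  unfold ndeg
  rw [← Set.InjOn.ncard_image (f := coverProj G φ j) (s := (cyclicCover G φ j).neighborSet a)]
  · congr 1
    ext w
    constructor
    · rintro ⟨b, hb, rfl⟩
      exact hb.1
    · intro hw
      obtain ⟨b, hab, hb⟩ := exists_cover_adj step a hw
      exact ⟨b, hab, hb⟩
  · exact fun b hb b' hb' h => coverProj_locally_injective hq a b b' hb hb' h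

theorem girth_cyclicCover
    (step : ∀ v w, G.Adj v w → ∃ e : ℤ, |e| ≤ 1 ∧ φ w = φ v + e)
    (hG : ¬ G.IsAcyclic) (hq : G.girth < q)
    (hφ : ∀ v, ∃ a : CoverVertex φ j, a.1.1 = v) :
    (cyclicCover G φ j).girth = G.girth := by
  have h3 := three_le_girth hG
  obtain ⟨v, c, hc, hlen⟩ := exists_girth_eq_length.2 hG
  obtain ⟨a, ha⟩ := hφ v
  obtain ⟨b, hb, p, hp, hpl⟩ := exists_cover_walk step c a ha.symm
  rw [← hlen] at hpl
  obtain ⟨e, he, hab⟩ := exists_pos_eq_of_cover_walk p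
  have hba : a = b := by
    refine cover_ext (d := 0) (x := a.1.2) (ha.trans hb) (by simp) hab ?_
    rw [zero_sub, abs_neg]
    omega
  subst hba
  subst ha
  have hpc : p.IsCycle := Walk.IsCycle.of_map (f := coverProj G φ j) (by
    rw [hp]
    exact hc)
  refine le_antisymm (hpl ▸ girth_le_length hpc) ?_
  have hnac : ¬ (cyclicCover G φ j).IsAcyclic := fun h => h p hpc
  obtain ⟨a', c', hc', hlen'⟩ := exists_girth_eq_length.2 hnac
  rw [hlen']
  exact girth_le_length_of_locally_injective _ (coverProj_locally_injective (by omega)) hc'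

end Cover

theorem card_coverVertex {q : ℕ} [NeZero q] (φ : V → ZMod q) (j : ℕ) [NeZero j] :
    Nat.card (CoverVertex φ j) = j * Nat.card V := by
  let F : V × Fin j → CoverVertex φ j := fun p =>
    ⟨(p.1, (((φ p.1).val + q * p.2 : ℕ) : ZMod (j * q))), by
      simp only [map_natCast]
      simp⟩
  have hF : F.Bijective := by
    have hlt : ∀ (v : V) (a : Fin j), (φ v).val + q * a < j * q := fun v a => by
      have h1 := ZMod.val_lt (φ v)
      have h2 : q * (a + 1) ≤ q * j := Nat.mul_le_mul_left _ a.2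
      rw [mul_comm j q]
      rw [mul_add] at h2
      omega
    constructor
    · rintro ⟨v, a⟩ ⟨w, b⟩ h
      have h1 : v = w := congrArg (fun x => x.1.1) h
      subst h1
      have h2 := congrArg (fun x => x.1.2.val) h
      simp only [F, ZMod.val_natCast, Nat.mod_eq_of_lt (hlt _ _)] at h2
      have h3 := Nat.eq_of_mul_eq_mul_left (NeZero.pos q) (Nat.add_left_cancel h2)
      rw [Fin.ext h3]
    · rintro ⟨⟨v, x⟩, hx⟩
      have hxlt : x.val < j * q := ZMod.val_lt x
      refine ⟨(v, ⟨x.val / q, Nat.div_lt_of_lt_mul (hxlt.trans_eq (mul_comm j q))⟩), ?_⟩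
      have hv : (φ v).val = x.val % q := by
        rw [← hx, ← ZMod.val_natCast]
        congr 1
        conv_lhs => rw [← ZMod.natCast_zmod_val x]
        exact map_natCast _ _
      refine Subtype.ext (Prod.ext rfl ?_)
      simp only [F, hv, Nat.mod_add_div, ZMod.natCast_zmod_val]
  rw [← Nat.card_eq_of_bijective F hF, Nat.card_prod, Nat.card_eq_fintype_card (α := Fin j),
    Fintype.card_fin, mul_comm]

/-- The cycle `u` lifted to the cover. -/
def coverCycle {q : ℕ} {φ : V → ZMod q} {u : ZMod q → V} (hu : ∀ i, φ (u i) = i) (j : ℕ)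
    (x : ZMod (j * q)) : CoverVertex φ j :=
  ⟨(u (modHom j q x), x), (hu _).symm⟩

theorem CyclicLayout.cyclicCover {G : SimpleGraph V} {q k : ℕ} {φ : V → ZMod q} {u : ZMod q → V}
    (h : CyclicLayout G q k φ u) (hq : 2 * k < q) (j : ℕ) :
    CyclicLayout (cyclicCover G φ j) (j * q) k (fun a => a.1.2) (coverCycle h.pos_u j) := by
  have lift : ∀ (a : CoverVertex φ j) (t : ℤ) (y : ZMod q) (x : ZMod (j * q)), |t| ≤ k →
      y = φ a.1.1 + t → x = a.1.2 + t → (∃ p : G.Walk a.1.1 (u y), p.length ≤ k) →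
      ∃ p : (_root_.cyclicCover G φ j).Walk a (coverCycle h.pos_u j x), p.length ≤ k := by
    rintro a t _ _ ht rfl rfl ⟨p, hp⟩
    obtain ⟨b, hb, p', -, hp'⟩ := exists_cover_walk h.step p a rfl
    have hlen : p'.length ≤ k := hp'.le.trans hp
    obtain ⟨e, he, hab⟩ := exists_pos_eq_of_cover_walk p'
    have hbu : b = coverCycle h.pos_u j (a.1.2 + t) := by
      refine cover_ext (d := e) (e := t) (x := a.1.2) ?_ hab rfl ?_
      · change coverProj G φ j b = _
        rw [← hb]
        simp only [coverCycle, map_add, map_intCast, a.2]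
      · have := abs_sub e t
        omega
    subst hbu
    exact ⟨p', hlen⟩
  refine ⟨fun _ => rfl, fun x => ⟨?_, 1, by simp, by simp [coverCycle]⟩, fun _ _ h => h.2,
    fun a => ?_, fun a => ?_⟩
  · simpa [coverCycle] using h.adj_u (modHom j q x)
  · exact lift a k _ _ (by simp) (by simp) (by simp) (h.fwd a.1.1)
  · exact lift a (-k) _ _ (by simp) (by simp [sub_eq_add_neg]) (by simp [sub_eq_add_neg])
      (h.bwd a.1.1)

/-! ### The Moore bound for disks -/

section Moore

variable {G : SimpleGraph V}

theorem dist_add_dist_le_of_mem_support {w a x : V} {p : G.Walk w a} (hp : p.length = G.dist w a)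
    (hx : x ∈ p.support) : G.dist w x + G.dist x a ≤ G.dist w a := by
  classical
  have h1 := dist_le (p.takeUntil x hx)
  have h2 := dist_le (p.dropUntil x hx)
  have h3 := congrArg Walk.length (p.take_spec hx)
  rw [Walk.length_append] at h3
  omega

theorem exists_isPath_notMem_support (hG : G.Connected) {v w a : V} (h : G.Adj v w)
    (hle : G.dist a w ≤ G.dist a v) :
    ∃ p : G.Walk w a, p.IsPath ∧ p.length = G.dist a w ∧ v ∉ p.support := by
  obtain ⟨p, hp, hlen⟩ := hG.exists_path_of_dist w a
  refine ⟨p, hp, by rw [hlen, SimpleGraph.dist_comm], fun hv => ?_⟩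
  have h1 := dist_add_dist_le_of_mem_support hlen hv
  have h2 := dist_eq_one_iff_adj.2 h.symm
  rw [SimpleGraph.dist_comm (u := v) (v := a), SimpleGraph.dist_comm (u := w) (v := a)] at h1
  omega

theorem girth_le_of_two_parents (hG : G.Connected) {v w₁ w₂ a : V} (h₁ : G.Adj v w₁)
    (h₂ : G.Adj v w₂) (hne : w₁ ≠ w₂) (hw₁ : G.dist a w₁ ≤ G.dist a v)
    (hw₂ : G.dist a w₂ ≤ G.dist a v) : G.girth ≤ G.dist a w₁ + G.dist a w₂ + 2 := by
  obtain ⟨p₁, hp₁, hl₁, hv₁⟩ := exists_isPath_notMem_support hG h₁ hw₁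
  obtain ⟨p₂, hp₂, hl₂, hv₂⟩ := exists_isPath_notMem_support hG h₂ hw₂
  have := girth_le_length_add_length (hp₁.cons (h := h₁) hv₁) (hp₂.cons (h := h₂) hv₂)
    (fun h => hne (by simpa using congrArg Walk.snd h))
  simp only [Walk.length_cons] at this
  omega

theorem girth_le_of_two_parents_of_adj (hG : G.Connected) {v w₁ w₂ a b : V} (hab : G.Adj a b)
    (hva : v ≠ a) (h₁ : G.Adj v w₁) (h₂ : G.Adj v w₂) (hne : w₁ ≠ w₂)
    (hw₁ : G.dist a w₁ ≤ G.dist a v) (hw₂ : G.dist b w₂ ≤ G.dist b v)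
    (hba : G.dist b w₂ ≤ G.dist a w₂) : G.girth ≤ G.dist a w₁ + G.dist b w₂ + 3 := by
  obtain ⟨p₁, hp₁, hl₁, hv₁⟩ := exists_isPath_notMem_support hG h₁ hw₁
  obtain ⟨p₂, hp₂, hl₂, hv₂⟩ := exists_isPath_notMem_support hG h₂ hw₂
  have ha : a ∉ p₂.support := fun ha => by
    have h1 := dist_add_dist_le_of_mem_support (by rw [hl₂, SimpleGraph.dist_comm]) ha
    rw [dist_eq_one_iff_adj.2 hab, SimpleGraph.dist_comm (u := w₂) (v := a),
      SimpleGraph.dist_comm (u := w₂) (v := b)] at h1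
    omega
  have hv : v ∉ (p₂.concat hab.symm).support := by
    rw [Walk.support_concat]
    simpa [hv₂] using hva
  have := girth_le_length_add_length (hp₁.cons (h := h₁) hv₁)
    ((hp₂.concat ha hab.symm).cons (h := h₂) hv)
    (fun h => hne (by simpa using congrArg Walk.snd h))
  simp only [Walk.length_cons, Walk.length_concat] at this
  omega

open Classical in
theorem card_layer_mul_le [Fintype V] {ρ : V → ℕ} {δ i : ℕ} (hδ : ∀ v, δ ≤ ndeg G v)
    (hstep : ∀ v w, G.Adj v w → ρ w ≤ ρ v + 1)
    (huniq : ∀ v w₁ w₂, G.Adj v w₁ → G.Adj v w₂ → i ≤ ρ v → ρ w₁ ≤ i → ρ w₂ ≤ i → w₁ = w₂) :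
    (Finset.univ.filter (ρ · = i)).card * (δ - 1) ≤ (Finset.univ.filter (ρ · = i + 1)).card := by
  conv_rhs => rw [← mul_one (Finset.card _)]
  refine Finset.card_mul_le_card_mul G.Adj (fun v hv => ?_) (fun w hw => ?_)
  · simp only [Finset.mem_filter, Finset.mem_univ, true_and] at hv
    have h1 : (Finset.univ.filter (G.Adj v)).card = ndeg G v := by
      rw [ndeg, Set.ncard_eq_toFinset_card']
      congr 1
      ext
      simp
    have h2 : (Finset.univ.filter fun w => G.Adj v w ∧ ρ w ≤ i).card ≤ 1 := by
      refine Finset.card_le_one.2 fun a ha b hb => ?_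
      simp only [Finset.mem_filter, Finset.mem_univ, true_and] at ha hb
      exact huniq v a b ha.1 hb.1 hv.ge ha.2 hb.2
    have h3 : Finset.univ.filter (G.Adj v) ⊆
        Finset.bipartiteAbove G.Adj (Finset.univ.filter (ρ · = i + 1)) v ∪
          Finset.univ.filter fun w => G.Adj v w ∧ ρ w ≤ i := by
      intro w hw
      simp only [Finset.mem_filter, Finset.mem_univ, true_and, Finset.mem_union,
        Finset.bipartiteAbove] at hw ⊢
      have := hstep v w hw
      by_cases hwi : ρ w ≤ i
      · exact .inr ⟨hw, hwi⟩
      · exact .inl ⟨by omega, hw⟩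
    have h4 := (Finset.card_le_card h3).trans (Finset.card_union_le _ _)
    have := hδ v
    omega
  · refine Finset.card_le_one.2 fun a ha b hb => ?_
    simp only [Finset.mem_filter, Finset.mem_univ, true_and, Finset.bipartiteBelow] at ha hb hw
    exact huniq w a b ha.2.symm hb.2.symm (by omega) ha.1.le hb.1.le

open Classical in
theorem card_filter_le_eq_sum [Fintype V] (ρ : V → ℕ) (k : ℕ) :
    (Finset.univ.filter (ρ · ≤ k)).card =
      ∑ i ∈ Finset.range (k + 1), (Finset.univ.filter (ρ · = i)).card := by
  rw [Finset.card_eq_sum_card_fiberwise (f := ρ) (t := Finset.range (k + 1))]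
  · refine Finset.sum_congr rfl fun i hi => ?_
    congr 1
    ext v
    simp only [Finset.mem_range, Finset.mem_filter, Finset.mem_univ, true_and] at hi ⊢
    omega
  · intro v hv
    simp only [Finset.coe_filter, Finset.mem_univ, true_and, Set.mem_ofPred_eq,
      Finset.coe_range, Set.mem_Iio] at hv ⊢
    omega

theorem mooreBound_le_ncard_disk [Finite V] (hG : G.Connected) {δ k : ℕ}
    (hg : G.girth = 2 * k + 1) (hδ : ∀ v, δ ≤ ndeg G v) (a : V) :
    mooreBound δ (2 * k + 1) ≤ (disk G k a).ncard := by
  classical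
  have := Fintype.ofFinite V
  have hstep : ∀ v w, G.Adj v w → G.dist a w ≤ G.dist a v + 1 := fun v w h => by
    have h1 := hG.dist_triangle (u := a) (v := v) (w := w)
    rwa [dist_eq_one_iff_adj.2 h] at h1
  have hmul : ∀ i < k, _ := fun i hi =>
    card_layer_mul_le (ρ := G.dist a) (i := i) hδ hstep fun v w₁ w₂ h₁ h₂ hv hw₁ hw₂ => by
      by_contra hne
      have := girth_le_of_two_parents hG h₁ h₂ hne (hw₁.trans hv) (hw₂.trans hv)
      omega
  have hlayer : ∀ i < k,
      δ * (δ - 1) ^ i ≤ (Finset.univ.filter (G.dist a · = i + 1)).card := by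
    intro i
    induction i with
    | zero =>
      intro _
      refine le_trans (by simpa using hδ a) (le_of_eq (?_ : ndeg G a = _))
      rw [ndeg, Set.ncard_eq_toFinset_card']
      congr 1
      ext w
      simp [dist_eq_one_iff_adj]
    | succ i ih =>
      intro hi
      rw [pow_succ, ← mul_assoc]
      exact (Nat.mul_le_mul_right _ (ih (by omega))).trans (hmul _ hi)
  have hcard : (disk G k a).ncard = (Finset.univ.filter (G.dist a · ≤ k)).card := by
    rw [disk, Set.ncard_eq_toFinset_card']
    congr 1
    ext
    simp
  rw [hcard, card_filter_le_eq_sum, Finset.sum_range_succ', mooreBound, if_pos ⟨k, rfl⟩,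
    show (2 * k + 1 + 1) / 2 - 1 = k by omega, add_comm, Finset.mul_sum]
  refine add_le_add (Finset.sum_le_sum fun i hi => hlayer i (Finset.mem_range.1 hi)) ?_
  exact Finset.card_pos.2 ⟨a, by simp⟩

theorem mooreBound_le_ncard_edisk [Finite V] (hG : G.Connected) {δ k : ℕ}
    (hg : G.girth = 2 * k + 2) (hδ : ∀ v, δ ≤ ndeg G v) {a b : V} (hab : G.Adj a b) :
    mooreBound δ (2 * k + 2) ≤ (edisk G k a b).ncard := by
  classical
  have := Fintype.ofFinite V
  have hdist : ∀ c v w, G.Adj v w → G.dist c w ≤ G.dist c v + 1 := fun c v w h => by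
    have h1 := hG.dist_triangle (u := c) (v := v) (w := w)
    rwa [dist_eq_one_iff_adj.2 h] at h1
  let ρ : V → ℕ := fun v => min (G.dist a v) (G.dist b v)
  have hstep : ∀ v w, G.Adj v w → ρ w ≤ ρ v + 1 := fun v w h => by
    have := hdist a v w h
    have := hdist b v w h
    simp only [ρ]
    omega
  have hzero : ∀ v, ρ v = 0 ↔ v = a ∨ v = b := fun v => by
    simp only [ρ, Nat.min_eq_zero_iff, hG.dist_eq_zero_iff, @eq_comm _ v]
  have hmul : ∀ i < k, _ := fun i hi =>
    card_layer_mul_le (ρ := ρ) (i := i) hδ hstep fun v w₁ w₂ h₁ h₂ hv hw₁ hw₂ => by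
      by_contra hne
      by_cases hva : v = a ∨ v = b
      · have hi0 : i = 0 := by
          have := (hzero v).2 hva
          omega
        have := (hzero w₁).1 (by omega)
        have := (hzero w₂).1 (by omega)
        have := h₁.ne
        have := h₂.ne
        grind
      · push Not at hva
        simp only [ρ] at hv hw₁ hw₂
        rcases le_total (G.dist a w₁) (G.dist b w₁) with c₁ | c₁ <;>
          rcases le_total (G.dist a w₂) (G.dist b w₂) with c₂ | c₂
        · have := girth_le_of_two_parents hG h₁ h₂ hne (a := a) (by omega) (by omega)
          omega
        · have := girth_le_of_two_parents_of_adj hG hab hva.1 h₁ h₂ hne (by omega) (by omega) c₂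
          omega
        · have := girth_le_of_two_parents_of_adj hG hab hva.1 h₂ h₁ (Ne.symm hne) (by omega)
            (by omega) c₁
          omega
        · have := girth_le_of_two_parents hG h₁ h₂ hne (a := b) (by omega) (by omega)
          omega
  have hlayer : ∀ i ≤ k, 2 * (δ - 1) ^ i ≤ (Finset.univ.filter (ρ · = i)).card := by
    intro i
    induction i with
    | zero =>
      intro _
      rw [pow_zero, mul_one, ← Finset.card_pair hab.ne]
      refine Finset.card_le_card fun v hv => ?_
      simp only [Finset.mem_filter, Finset.mem_univ, true_and]
      exact (hzero v).2 (by simpa using hv)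
    | succ i ih =>
      intro hi
      rw [pow_succ, ← mul_assoc]
      exact (Nat.mul_le_mul_right _ (ih (by omega))).trans (hmul _ hi)
  have hcard : (edisk G k a b).ncard = (Finset.univ.filter (ρ · ≤ k)).card := by
    rw [edisk, disk, disk, Set.ncard_eq_toFinset_card']
    congr 1
    ext
    simp [ρ]
  have hsum : ∀ k : ℕ, 2 + ∑ i ∈ Finset.Icc 1 k, 2 * (δ - 1) ^ i =
      ∑ i ∈ Finset.range (k + 1), 2 * (δ - 1) ^ i := fun k => by
    induction k with
    | zero => simp
    | succ k ih => rw [Finset.sum_Icc_succ_top (by omega), ← add_assoc, ih,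
        ← Finset.sum_range_succ]
  rw [hcard, card_filter_le_eq_sum, mooreBound,
    if_neg (by rw [Nat.not_odd_iff_even]; exact ⟨k + 1, by ring⟩),
    show (2 * k + 2 + 1) / 2 - 1 = k by omega, hsum]
  exact Finset.sum_le_sum fun i hi => hlayer i (by simpa [Nat.lt_succ_iff] using hi)

end Moore

/-! ### The layout of an equatorial graph -/

theorem exists_arc_of_cycleDist_le_s16 {q k : ℕ} (hq : 6 * k < q) {A : Set (ZMod q)}
    (hA : A.Nonempty) (hd : ∀ x ∈ A, ∀ y ∈ A, cycleDist x y ≤ 2 * k) :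
    ∃ (c : ZMod q) (t : ℕ), t ≤ 2 * k ∧ c ∈ A ∧ c + t ∈ A ∧ ∀ x ∈ A, ∃ s ≤ t, x = c + (s : ℕ) := by
  classical
  have : NeZero q := ⟨by omega⟩
  obtain ⟨x₀, hx₀⟩ := hA
  let D : Finset ℤ := (Finset.Icc (-(2 * k : ℤ)) (2 * k)).filter fun d => x₀ + (d : ZMod q) ∈ A
  have hD : D.Nonempty := ⟨0, by simp [D, hx₀]⟩
  have hmin := D.min'_mem hD
  have hmax := D.max'_mem hD
  have hmm := D.min'_le_max' hD
  have hminle : ∀ d ∈ D, D.min' hD ≤ d := fun d hd => D.min'_le d hd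
  have hlemax : ∀ d ∈ D, d ≤ D.max' hD := fun d hd => D.le_max' d hd
  generalize D.min' hD = m at *
  generalize D.max' hD = M at *
  simp only [D, Finset.mem_filter, Finset.mem_Icc] at hmin hmax
  obtain ⟨d, hd1, hd2⟩ := (cycleDist_le_iff _ _ _).1 (hd _ hmin.2 _ hmax.2)
  push_cast at hd1
  have hMd : M = m + d := by
    refine intCast_zmod_inj (q := q) ?_ ?_
    · push_cast
      rwa [add_assoc, add_right_inj] at hd2
    · rw [abs_lt]
      rw [abs_le] at hd1
      omega
  rw [abs_le] at hd1
  have hcast : ∀ e : ℤ, m ≤ e → x₀ + (e : ZMod q) = x₀ + m + ((e - m).toNat : ZMod q) := by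
    intro e he
    have h1 : (((e - m).toNat : ℤ) : ZMod q) = ((e - m : ℤ) : ZMod q) := by
      rw [Int.toNat_of_nonneg (by omega)]
    push_cast at h1
    rw [h1]
    ring
  refine ⟨x₀ + m, (M - m).toNat, by omega, hmin.2, by rw [← hcast M hmm]; exact hmax.2, ?_⟩
  intro x hx
  obtain ⟨e, he, rfl⟩ := (cycleDist_le_iff _ _ _).1 (hd _ hx₀ _ hx)
  push_cast at he
  rw [abs_le] at he
  have heD : e ∈ D := by
    simp only [D, Finset.mem_filter, Finset.mem_Icc]
    exact ⟨by omega, hx⟩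
  have h1 := hminle e heD
  have h2 := hlemax e heD
  exact ⟨(e - m).toNat, by omega, hcast e h1⟩

theorem card_arc_le_s16 {q n : ℕ} {B : Finset (ZMod q)} {c : ZMod q}
    (hB : ∀ x ∈ B, ∃ s < n, x = c + (s : ℕ)) : B.card ≤ n := by
  classical
  have : B ⊆ (Finset.range n).image fun s : ℕ => c + (s : ZMod q) := fun x hx => by
    obtain ⟨s, hs, rfl⟩ := hB x hx
    exact Finset.mem_image.2 ⟨s, by simpa using hs, rfl⟩
  simpa using (Finset.card_le_card this).trans Finset.card_image_le

theorem mem_of_card_arc {q n : ℕ} {B : Finset (ZMod q)} {c : ZMod q}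
    (hB : ∀ x ∈ B, ∃ s < n, x = c + (s : ℕ)) (hn : n ≤ B.card) {s : ℕ} (hs : s < n) :
    c + (s : ℕ) ∈ B := by
  classical
  have hsub : B ⊆ (Finset.range n).image fun s : ℕ => c + (s : ZMod q) := fun x hx => by
    obtain ⟨s, hs, rfl⟩ := hB x hx
    exact Finset.mem_image.2 ⟨s, by simpa using hs, rfl⟩
  have heq := Finset.eq_of_subset_of_card_le hsub (by
    refine Finset.card_image_le.trans ?_
    simpa using hn)
  rw [heq]
  exact Finset.mem_image.2 ⟨s, by simpa using hs, rfl⟩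

open Classical in
/-- Equality in a double count: `q` sets of size at least `M` on `q * M / g` points, no point
being covered more than `g` times. -/
theorem card_cover_eq [Fintype V] {q g M : ℕ} [NeZero q] {E : ZMod q → Set V}
    (hE : ∀ i, M ≤ (E i).ncard)
    (hle : ∀ v, (Finset.univ.filter fun i => v ∈ E i).card ≤ g)
    (hcard : g * Nat.card V = q * M) (v : V) :
    (Finset.univ.filter fun i => v ∈ E i).card = g := by
  have h1 : ∑ v, (Finset.univ.filter fun i => v ∈ E i).card = ∑ i, (E i).ncard := by
    have := Finset.sum_card_bipartiteAbove_eq_sum_card_bipartiteBelow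
      (s := (Finset.univ : Finset V)) (t := (Finset.univ : Finset (ZMod q))) fun v i => v ∈ E i
    simp only [Finset.bipartiteAbove, Finset.bipartiteBelow] at this
    rw [this]
    refine Finset.sum_congr rfl fun i _ => ?_
    rw [Set.ncard_eq_toFinset_card']
    congr 1
    ext
    simp
  have h2 : q * M ≤ ∑ i, (E i).ncard := by
    have := Finset.card_nsmul_le_sum Finset.univ (fun i => (E i).ncard) M fun i _ => hE i
    simpa [ZMod.card] using this
  have h3 : ∑ _v : V, g = g * Nat.card V := by simp [mul_comm]
  have h4 := (Finset.sum_eq_sum_iff_of_le (s := Finset.univ)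
    fun v _ => hle v).1 (le_antisymm (Finset.sum_le_sum fun v _ => hle v) (by omega))
  exact h4 v (Finset.mem_univ v)

/-- `c` is the position of `v` relative to the cycle `u`. -/
def IsCenter (G : SimpleGraph V) (k : ℕ) {q : ℕ} (u : ZMod q → V) (v : V) (c : ZMod q) : Prop :=
  G.dist (u (c - k)) v ≤ k ∧ G.dist (u (c + k)) v ≤ k ∧
    (G.dist (u c) v ≤ k ∨ G.dist (u (c + 1)) v ≤ k)

section Layout

variable {G : SimpleGraph V} {k q : ℕ} {u : ZMod q → V}

theorem mem_disk {a v : V} : v ∈ disk G k a ↔ G.dist a v ≤ k := Iff.rfl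

theorem cycleDist_le_of_near (hG : G.Connected)
    (hu : ∀ i j, G.dist (u i) (u j) = cycleDist i j) (v : V) :
    ∀ x ∈ {i | G.dist (u i) v ≤ k}, ∀ y ∈ {i | G.dist (u i) v ≤ k}, cycleDist x y ≤ 2 * k := by
  intro x (hx : _ ≤ k) y (hy : _ ≤ k)
  rw [← hu]
  have := hG.dist_triangle (u := u x) (v := v) (w := u y)
  rw [SimpleGraph.dist_comm (u := v)] at this
  omega

theorem exists_isCenter_of_odd [Finite V] (hG : G.Connected) {δ : ℕ}
    (hg : G.girth = 2 * k + 1) (hδ : ∀ v, δ ≤ ndeg G v) (hq : 6 * k < q)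
    (hu : ∀ i j, G.dist (u i) (u j) = cycleDist i j)
    (hcard : (2 * k + 1) * Nat.card V = q * mooreBound δ (2 * k + 1)) (v : V) :
    ∃ c, IsCenter G k u v c := by
  classical
  have : NeZero q := ⟨by omega⟩
  have := Fintype.ofFinite V
  have hle : ∀ v, (Finset.univ.filter fun i => v ∈ disk G k (u i)).card ≤ 2 * k + 1 := fun v => by
    rcases Set.eq_empty_or_nonempty {i | G.dist (u i) v ≤ k} with he | hne
    · have : (Finset.univ.filter fun i => v ∈ disk G k (u i)) = ∅ := by
        refine Finset.filter_eq_empty_iff.2 fun i _ hi => ?_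
        exact (Set.eq_empty_iff_forall_notMem.1 he) i hi
      simp [this]
    · obtain ⟨c, t, ht, -, -, hA⟩ := exists_arc_of_cycleDist_le_s16 hq hne
        (cycleDist_le_of_near hG hu v)
      refine card_arc_le_s16 (c := c) fun x hx => ?_
      obtain ⟨s, hs, hx⟩ := hA x (by simpa [mem_disk] using hx)
      exact ⟨s, by omega, hx⟩
  have heq := card_cover_eq (fun i => mooreBound_le_ncard_disk hG hg hδ (u i)) hle hcard v
  have hne : {i | G.dist (u i) v ≤ k}.Nonempty := by
    obtain ⟨i, hi⟩ := Finset.card_pos.1 (by omega :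
      0 < (Finset.univ.filter fun i => v ∈ disk G k (u i)).card)
    exact ⟨i, by simpa [mem_disk] using hi⟩
  obtain ⟨c, t, ht, -, -, hA⟩ := exists_arc_of_cycleDist_le_s16 hq hne
        (cycleDist_le_of_near hG hu v)
  have hmem : ∀ s < 2 * k + 1, G.dist (u (c + (s : ℕ))) v ≤ k := fun s hs => by
    have := mem_of_card_arc (n := 2 * k + 1) (c := c) (fun x hx => by
      obtain ⟨s, hs, hx⟩ := hA x (by simpa [mem_disk] using hx)
      exact ⟨s, by omega, hx⟩) heq.ge hs
    simpa [mem_disk] using this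
  refine ⟨c + k, by simpa using hmem 0 (by omega), ?_, .inl (hmem k (by omega))⟩
  have := hmem (2 * k) (by omega)
  rwa [show c + ((2 * k : ℕ) : ZMod q) = c + k + k by push_cast; ring] at this

theorem exists_isCenter_of_even [Finite V] (hG : G.Connected) {δ : ℕ}
    (hg : G.girth = 2 * k + 2) (hδ : ∀ v, δ ≤ ndeg G v) (hq : 6 * k < q)
    (hu : ∀ i j, G.dist (u i) (u j) = cycleDist i j) (hadj : ∀ i, G.Adj (u i) (u (i + 1)))
    (hcard : (2 * k + 2) * Nat.card V = q * mooreBound δ (2 * k + 2)) (v : V) :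
    ∃ c, IsCenter G k u v c := by
  classical
  have : NeZero q := ⟨by omega⟩
  have := Fintype.ofFinite V
  let B : V → Finset (ZMod q) := fun v =>
    Finset.univ.filter fun i => v ∈ edisk G k (u i) (u (i + 1))
  have hB : ∀ v i, i ∈ B v ↔ G.dist (u i) v ≤ k ∨ G.dist (u (i + 1)) v ≤ k := fun v i => by
    simp [B, edisk, disk]
  have harc : ∀ {v : V} {c : ZMod q} {t : ℕ},
      (∀ x ∈ {i | G.dist (u i) v ≤ k}, ∃ s ≤ t, x = c + (s : ℕ)) →
      ∀ x ∈ B v, ∃ s < t + 2, x = c - 1 + (s : ℕ) := fun {v c t} hA x hx => by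
    rcases (hB v x).1 hx with hx | hx
    · obtain ⟨s, hs, rfl⟩ := hA x hx
      exact ⟨s + 1, by omega, by push_cast; ring⟩
    · obtain ⟨s, hs, hx⟩ := hA _ hx
      exact ⟨s, by omega, by rw [eq_sub_of_add_eq hx]; ring⟩
  have hle : ∀ v, (B v).card ≤ 2 * k + 2 := fun v => by
    rcases Set.eq_empty_or_nonempty {i | G.dist (u i) v ≤ k} with he | hne
    · have : B v = ∅ := by
        refine Finset.eq_empty_iff_forall_notMem.2 fun i hi => ?_
        rcases (hB v i).1 hi with hi | hi
        · exact (Set.eq_empty_iff_forall_notMem.1 he) _ hi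
        · exact (Set.eq_empty_iff_forall_notMem.1 he) _ hi
      simp [this]
    · obtain ⟨c, t, ht, -, -, hA⟩ := exists_arc_of_cycleDist_le_s16 hq hne
        (cycleDist_le_of_near hG hu v)
      have := card_arc_le_s16 (harc hA)
      omega
  have heq : (B v).card = 2 * k + 2 :=
    card_cover_eq (fun i => mooreBound_le_ncard_edisk hG hg hδ (hadj i)) hle hcard v
  have hne : {i | G.dist (u i) v ≤ k}.Nonempty := by
    obtain ⟨i, hi⟩ := Finset.card_pos.1 (by omega : 0 < (B v).card)
    rcases (hB v i).1 hi with hi | hi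
    · exact ⟨_, hi⟩
    · exact ⟨_, hi⟩
  obtain ⟨c, t, ht, hc, hct, hA⟩ := exists_arc_of_cycleDist_le_s16 hq hne
        (cycleDist_le_of_near hG hu v)
  have h1 := card_arc_le_s16 (harc hA)
  obtain rfl : t = 2 * k := by omega
  have h2 := (hB _ _).1 (mem_of_card_arc (harc hA) heq.ge (s := k + 1) (by omega))
  rw [show c - 1 + ((k + 1 : ℕ) : ZMod q) = c + k by push_cast; ring] at h2
  rw [show c + ((2 * k : ℕ) : ZMod q) = c + k + k by push_cast; ring] at hct
  exact ⟨c + k, by simpa using hc, hct, h2⟩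

theorem exists_int_of_dist_le (hG : G.Connected) [NeZero q]
    (hu : ∀ i j, G.dist (u i) (u j) = cycleDist i j) {v w : V} {x y : ZMod q} {n : ℕ}
    (hx : G.dist (u x) v ≤ k) (hy : G.dist (u y) w ≤ k) (hvw : G.dist v w ≤ n) :
    ∃ e : ℤ, |e| ≤ 2 * k + n ∧ y = x + e := by
  have h1 := hG.dist_triangle (u := u x) (v := v) (w := u y)
  have h2 := hG.dist_triangle (u := v) (v := w) (w := u y)
  rw [SimpleGraph.dist_comm (u := w)] at h2
  have h3 : cycleDist x y ≤ 2 * k + n := by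
    rw [← hu]
    omega
  simpa using (cycleDist_le_iff _ _ _).1 h3

theorem IsCenter.exists_int (hG : G.Connected) (hq : 6 * k + 3 < q)
    (hu : ∀ i j, G.dist (u i) (u j) = cycleDist i j) {v w : V} {n : ℕ} (hn : n ≤ 1)
    (hvw : G.dist v w ≤ n) {c d : ZMod q} (hc : IsCenter G k u v c) (hd : IsCenter G k u w d) :
    ∃ e : ℤ, |e| ≤ n ∧ d = c + e := by
  have : NeZero q := ⟨by omega⟩
  obtain ⟨c₁, c₂, c₃⟩ := hc
  obtain ⟨d₁, d₂, d₃⟩ := hd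
  obtain ⟨e, he, hde⟩ : ∃ e : ℤ, |e| ≤ 2 * k + n + 1 ∧ d = c + e := by
    rcases c₃ with c₃ | c₃ <;> rcases d₃ with d₃ | d₃ <;>
      obtain ⟨e, he, h⟩ := exists_int_of_dist_le hG hu c₃ d₃ hvw <;> rw [abs_le] at he
    · exact ⟨e, by rw [abs_le]; omega, h⟩
    · exact ⟨e - 1, by rw [abs_le]; omega, by rw [eq_sub_of_add_eq h]; push_cast; ring⟩
    · exact ⟨e + 1, by rw [abs_le]; omega, by rw [h]; push_cast; ring⟩
    · exact ⟨e, by rw [abs_le]; omega, by rw [eq_sub_of_add_eq h]; ring⟩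
  obtain ⟨a, ha, hca⟩ := exists_int_of_dist_le hG hu c₁ d₂ hvw
  obtain ⟨b, hb, hcb⟩ := exists_int_of_dist_le hG hu c₂ d₁ hvw
  rw [abs_le] at he ha hb
  subst hde
  have h1 : e + 2 * k = a := by
    refine intCast_zmod_inj (q := q) ?_ (by rw [abs_lt]; omega)
    push_cast
    linear_combination hca
  have h2 : e - 2 * k = b := by
    refine intCast_zmod_inj (q := q) ?_ (by rw [abs_lt]; omega)
    push_cast
    linear_combination hcb
  exact ⟨e, by rw [abs_le]; omega, rfl⟩

theorem exists_cyclicLayout (hG : G.Connected) (hq : 6 * k + 3 < q)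
    (hu : ∀ i j, G.dist (u i) (u j) = cycleDist i j) (hadj : ∀ i, G.Adj (u i) (u (i + 1)))
    (hcenter : ∀ v, ∃ c, IsCenter G k u v c) : ∃ φ, CyclicLayout G q k φ u := by
  have : NeZero q := ⟨by omega⟩
  choose φ hφ using hcenter
  have hself : ∀ i, IsCenter G k u (u i) i := fun i => by
    refine ⟨?_, ?_, .inl (by simp)⟩ <;> rw [hu, cycleDist_le_iff]
    · exact ⟨k, by simp⟩
    · exact ⟨-k, by simp⟩
  have hwalk : ∀ v x, G.dist (u x) v ≤ k → ∃ p : G.Walk v (u x), p.length ≤ k := fun v x h => by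
    obtain ⟨p, hp⟩ := hG.exists_walk_length_eq_dist v (u x)
    exact ⟨p, by rwa [hp, SimpleGraph.dist_comm]⟩
  refine ⟨φ, fun i => ?_, hadj, fun v w h => ?_, fun v => hwalk _ _ (hφ v).2.1,
    fun v => hwalk _ _ (hφ v).1⟩
  · obtain ⟨e, he, h⟩ :=
      (hself i).exists_int hG hq hu zero_le_one (by simp) (hφ (u i))
    simp only [Nat.cast_zero, abs_nonpos_iff] at he
    simpa [he] using h
  · simpa using (hφ v).exists_int hG hq hu le_rfl (dist_eq_one_iff_adj.2 h).le (hφ w)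

end Layout

theorem IsEquatorial.exists_cyclicLayout {G : SimpleGraph V} {δ g q : ℕ}
    (h : IsEquatorial G δ g q) :
    ∃ φ u, CyclicLayout G q ((g + 1) / 2 - 1) φ u := by
  obtain ⟨hfin, hG, hg, ⟨hδ, -⟩, ⟨hiso, -⟩, hq, hcard⟩ := h
  obtain ⟨u, -, hu⟩ := hiso.resolve_right (by omega)
  have : NeZero q := ⟨by omega⟩
  have hadj : ∀ i, G.Adj (u i) (u (i + 1)) := fun i => by
    have := cycleDist_add_natCast i (n := 1) (by omega)
    rw [← dist_eq_one_iff_adj, hu]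
    push_cast at this
    omega
  refine Exists.imp' _ (fun φ hφ => ⟨u, hφ⟩)
    (_root_.exists_cyclicLayout hG hq hu hadj fun v => ?_)
  rcases Nat.even_or_odd' g with ⟨k, rfl | rfl⟩
  · obtain ⟨k, rfl⟩ : ∃ k', k = k' + 1 := by
      refine Nat.exists_eq_add_one.2 (Nat.pos_of_ne_zero fun h0 => ?_)
      subst h0
      simp [mooreBound] at hcard
      omega
    rw [show (2 * (k + 1) + 1) / 2 - 1 = k by omega] at *
    exact exists_isCenter_of_even hG hg hδ (by omega) hu hadj hcard v
  · rw [show (2 * k + 1 + 1) / 2 - 1 = k by omega] at *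
    exact exists_isCenter_of_odd hG hg hδ (by omega) hu hcard v

/-- Proposition 6.1: if there is an equatorial graph with minimum degree `δ`, girth `g` and
equator `q`, then for every `j ≥ 2` there is one with the same degree and girth and
equator `j·q`. -/
theorem stmt_16 (δ g q : ℕ)
    (h : ∃ (W : Type) (G : SimpleGraph W), IsEquatorial G δ g q) :
    ∀ j : ℕ, 2 ≤ j → ∃ (W : Type) (G : SimpleGraph W), IsEquatorial G δ g (j * q) := by
  intro j hj
  obtain ⟨W, G, hE⟩ := h
  obtain ⟨φ, u, hL⟩ := hE.exists_cyclicLayout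
  obtain ⟨hfin, -, hg, ⟨hδ, v, hv⟩, -, hq, hcard⟩ := hE
  have hjq : 2 * q ≤ j * q := Nat.mul_le_mul_right q hj
  have : NeZero q := ⟨by omega⟩
  have : NeZero j := ⟨by omega⟩
  have hac : ¬ G.IsAcyclic := fun hac => by
    have h0 : g = 0 := hg.symm.trans (girth_eq_zero.2 hac)
    subst h0
    simp [mooreBound] at hcard
    omega
  have hLj := hL.cyclicCover (by omega) j
  have hlift : ∀ v, ∃ a : CoverVertex φ j, a.1.1 = v := fun v => by
    obtain ⟨x, hx⟩ := ZMod.castHom_surjective (dvd_mul_left q j) (φ v)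
    exact ⟨⟨(v, x), hx⟩, rfl⟩
  refine ⟨CoverVertex φ j, cyclicCover G φ j, inferInstance, hLj.connected, ?_, ⟨fun a => ?_, ?_⟩,
    hLj.isEquator (by omega), by omega, ?_⟩
  · rw [girth_cyclicCover hL.step hac (by omega) hlift, hg]
  · rw [ndeg_cyclicCover hL.step (by omega)]
    exact hδ _
  · obtain ⟨a, rfl⟩ := hlift v
    exact ⟨a, by rw [ndeg_cyclicCover hL.step (by omega), hv]⟩
  · rw [card_coverVertex, mul_left_comm, hcard, mul_assoc]
end
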